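/- For every a ∈ A₄*, every ε ∈ {1,−1} and every r ∈ {1,2}, the squared norm (a+εδʳ | a+εδʳ) lies in (2/5)·ℤ and satisfies (a+εδʳ | a+εδʳ) ≥ 2/5; in particular a + εδʳ ≠ 0. -/

import Mathlib

/-- The standard inner product on ℝ⁵. -/
def ip5 (x y : Fin 5 → ℝ) : ℝ := ∑ i, x i * y i

/-- The A₄ root lattice: integer vectors in ℝ⁵ with coordinate sum 0. -/
def A4lat : Set (Fin 5 → ℝ) := {a | (∀ i, ∃ n : ℤ, a i = n) ∧ (∑ i, a i) = 0}

/-- The dual lattice A₄* inside the sum-zero hyperplane. -/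
def A4dual : Set (Fin 5 → ℝ) :=
  {x | (∑ i, x i) = 0 ∧ ∀ a ∈ A4lat, ∃ n : ℤ, ip5 x a = n}

noncomputable def δ1 : Fin 5 → ℝ := (1 / 5 : ℝ) • ![2, 1, 0, -1, -2]

noncomputable def δ2 : Fin 5 → ℝ := (1 / 5 : ℝ) • ![-1, 2, 0, -2, 1]

/-- The norm of `x` vanishes only if all its coordinates do. -/
lemma eq_zero_of_ip5_self_eq_zero {x : Fin 5 → ℝ} (h : ip5 x x = 0) : x = 0 := by
  funext i
  exact mul_self_eq_zero.mp
    ((Finset.sum_eq_zero_iff_of_nonneg fun j _ => mul_self_nonneg (x j)).mp h i (Finset.mem_univ i))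

lemma ip5_self_nonneg (x : Fin 5 → ℝ) : 0 ≤ ip5 x x :=
  Finset.sum_nonneg fun i _ => mul_self_nonneg (x i)

/-- Differences of coordinates of a vector of `A4dual` are integers. -/
lemma exists_int_sub_eq_of_mem_A4dual {a : Fin 5 → ℝ} (ha : a ∈ A4dual) (i j : Fin 5) :
    ∃ n : ℤ, a i - a j = n := by
  obtain ⟨n, hn⟩ := ha.2 (Pi.single i 1 - Pi.single j 1) (by
    refine ⟨fun k => ⟨(Pi.single i 1 - Pi.single j 1 : Fin 5 → ℤ) k, ?_⟩, ?_⟩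
    · simp [Pi.single_apply]
    · simp)
  refine ⟨n, ?_⟩
  simpa [ip5, mul_sub, Pi.single_apply] using hn

/-- If `e` is an integer vector of coordinate sum `0` and norm `10`, then the norm of a translate
of `e / 5` by `A4dual` lies in `(2 / 5) ℤ`. -/
lemma exists_int_ip5_add_eq {a : Fin 5 → ℝ} (ha : a ∈ A4dual) {e : Fin 5 → ℤ}
    (hsum : ∑ i, e i = 0) (hnorm : ∑ i, e i * e i = 10) {v : Fin 5 → ℝ}
    (hv : ∀ i, v i = a i + e i / 5) : ∃ n : ℤ, ip5 v v = (2 / 5) * n := by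
  obtain ⟨m₀, h₀⟩ := exists_int_sub_eq_of_mem_A4dual ha 0 4
  obtain ⟨m₁, h₁⟩ := exists_int_sub_eq_of_mem_A4dual ha 1 4
  obtain ⟨m₂, h₂⟩ := exists_int_sub_eq_of_mem_A4dual ha 2 4
  obtain ⟨m₃, h₃⟩ := exists_int_sub_eq_of_mem_A4dual ha 3 4
  have hs := ha.1
  simp only [Fin.sum_univ_five] at hs hsum hnorm
  have hsum' : (e 0 + e 1 + e 2 + e 3 + e 4 : ℝ) = 0 := mod_cast hsum
  have hnorm' : (e 0 * e 0 + e 1 * e 1 + e 2 * e 2 + e 3 * e 3 + e 4 * e 4 : ℝ) = 10 :=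
    mod_cast hnorm
  have h₄ : a 4 = -(m₀ + m₁ + m₂ + m₃) / 5 := by linarith
  refine ⟨2 * (m₀ ^ 2 + m₁ ^ 2 + m₂ ^ 2 + m₃ ^ 2)
    - (m₀ * m₁ + m₀ * m₂ + m₀ * m₃ + m₁ * m₂ + m₁ * m₃ + m₂ * m₃)
    + (m₀ * e 0 + m₁ * e 1 + m₂ * e 2 + m₃ * e 3) + 1, ?_⟩
  simp only [ip5, Fin.sum_univ_five, hv]
  rw [sub_eq_iff_eq_add.mp h₀, sub_eq_iff_eq_add.mp h₁, sub_eq_iff_eq_add.mp h₂,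
    sub_eq_iff_eq_add.mp h₃, h₄]
  push_cast
  linear_combination (1 / 25) * hnorm' - (2 / 25) * (m₀ + m₁ + m₂ + m₃ : ℝ) * hsum'

/-- A translate of `e / 5` by `A4dual` is nonzero if two coordinates of `e` differ modulo `5`. -/
lemma add_ne_zero_of_not_dvd {a : Fin 5 → ℝ} (ha : a ∈ A4dual) {e : Fin 5 → ℤ} {i j : Fin 5}
    (hij : ¬ 5 ∣ e i - e j) {v : Fin 5 → ℝ} (hv : ∀ i, v i = a i + e i / 5) : v ≠ 0 := by
  rintro rfl
  obtain ⟨m, hm⟩ := exists_int_sub_eq_of_mem_A4dual ha i j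
  have hi := hv i
  have hj := hv j
  simp only [Pi.zero_apply] at hi hj
  refine hij ⟨-m, ?_⟩
  have : (e i - e j : ℝ) = 5 * -m := by linarith
  exact_mod_cast this

theorem stmt_8 :
    ∀ a ∈ A4dual, ∀ ε : ℝ, (ε = 1 ∨ ε = -1) → ∀ d : Fin 5 → ℝ, (d = δ1 ∨ d = δ2) →
      (∃ n : ℤ, ip5 (a + ε • d) (a + ε • d) = (2 / 5) * n) ∧
      ip5 (a + ε • d) (a + ε • d) ≥ 2 / 5 ∧
      a + ε • d ≠ 0 := by
  intro a ha ε hε d hd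
  obtain ⟨e, hsum, hnorm, hij, hv⟩ : ∃ e : Fin 5 → ℤ, ∑ i, e i = 0 ∧ ∑ i, e i * e i = 10 ∧
      ¬ 5 ∣ e 0 - e 4 ∧ ∀ i, (a + ε • d) i = a i + e i / 5 := by
    rcases hε with rfl | rfl <;> rcases hd with rfl | rfl
    · refine ⟨![2, 1, 0, -1, -2], by decide, by decide, by decide, fun i => ?_⟩
      fin_cases i <;> simp [δ1] <;> ring
    · refine ⟨![-1, 2, 0, -2, 1], by decide, by decide, by decide, fun i => ?_⟩
      fin_cases i <;> simp [δ2] <;> ring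
    · refine ⟨![-2, -1, 0, 1, 2], by decide, by decide, by decide, fun i => ?_⟩
      fin_cases i <;> simp [δ1] <;> ring
    · refine ⟨![1, -2, 0, 2, -1], by decide, by decide, by decide, fun i => ?_⟩
      fin_cases i <;> simp [δ2] <;> ring
  have hne := add_ne_zero_of_not_dvd ha hij hv
  obtain ⟨n, hn⟩ := exists_int_ip5_add_eq ha hsum hnorm hv
  refine ⟨⟨n, hn⟩, ?_, hne⟩
  have hpos : 0 < ip5 (a + ε • d) (a + ε • d) :=
    (ip5_self_nonneg _).lt_of_ne' fun h => hne (eq_zero_of_ip5_self_eq_zero h)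
  have hn0 : (0 : ℝ) < n := by linarith
  have hn1 : (1 : ℝ) ≤ n := by exact_mod_cast Int.cast_pos.mp hn0
  linarith
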